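/- Let ω ∈ ℝ and let ψ : ℝ × ℝ³ → ℝ be infinitely differentiable whose time-dependent spherical-coordinate representation Ψ(t,φ,θ) satisfies the vorticity equation (E_ω). Then the kinetic energy t ↦ (1/2) ∫₀^{2π} ∫_{−π/2}^{π/2} [ (∂θΨ(t,φ,θ))² + (∂φΨ(t,φ,θ))²/cos²θ ] cos θ dθ dφ is constant in time. -/

import Mathlib

open Real MeasureTheory

noncomputable section

/-- The point of the unit sphere with longitude `φ` and latitude `θ`. -/
def sphPt (φ θ : ℝ) : ℝ × ℝ × ℝ :=
  (Real.cos φ * Real.cos θ, Real.sin φ * Real.cos θ, Real.sin θ)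

/-- The spherical-coordinate representation of a function `ψ : ℝ³ → ℝ`. -/
def sphRep (ψ : ℝ × ℝ × ℝ → ℝ) (φ θ : ℝ) : ℝ := ψ (sphPt φ θ)

/-- The Laplace–Beltrami operator of the unit sphere in longitude-latitude coordinates:
`(ΔΨ)(φ,θ) = ∂θ²Ψ − tan θ · ∂θΨ + (1/cos²θ) · ∂φ²Ψ`. -/
def LB (Ψ : ℝ → ℝ → ℝ) (φ θ : ℝ) : ℝ :=
  iteratedDeriv 2 (fun θ' => Ψ φ θ') θ
    - Real.tan θ * deriv (fun θ' => Ψ φ θ') θ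
    + (1 / Real.cos θ ^ 2) * iteratedDeriv 2 (fun φ' => Ψ φ' θ) φ

/-- The vorticity (Euler) equation `(E_ω)` on the sphere rotating at speed `ω`, for a
time-dependent stream function with representation `Ψ t φ θ`:
`∂t(ΔΨ) + (1/cos θ)·[∂φΨ · ∂θ(ΔΨ + 2ω sin θ) − ∂θΨ · ∂φ(ΔΨ + 2ω sin θ)] = 0`. -/
def EulerEq (ω : ℝ) (Ψ : ℝ → ℝ → ℝ → ℝ) : Prop :=
  ∀ t φ θ : ℝ, θ ∈ Set.Ioo (-(π/2)) (π/2) →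
    deriv (fun t' => LB (Ψ t') φ θ) t
      + (1 / Real.cos θ) *
        (deriv (fun φ' => Ψ t φ' θ) φ *
            deriv (fun θ' => LB (Ψ t) φ θ' + 2 * ω * Real.sin θ') θ
          - deriv (fun θ' => Ψ t φ θ') θ *
            deriv (fun φ' => LB (Ψ t) φ' θ + 2 * ω * Real.sin θ) φ) = 0

/-- The directional derivative of `f` along the constant vector `v`. -/
def pd (v : ℝ × ℝ × ℝ) (f : ℝ × ℝ × ℝ → ℝ) (x : ℝ × ℝ × ℝ) : ℝ := fderiv ℝ f x v

lemma ContDiff.pd {f : ℝ × ℝ × ℝ → ℝ} (hf : ContDiff ℝ (⊤ : ℕ∞) f) (v : ℝ × ℝ × ℝ) :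
    ContDiff ℝ (⊤ : ℕ∞) (pd v f) :=
  (hf.fderiv_right (m := (⊤ : ℕ∞)) (by simp)).clm_apply contDiff_const

lemma pd_comm {f : ℝ × ℝ × ℝ → ℝ} (hf : ContDiff ℝ (⊤ : ℕ∞) f) (v w : ℝ × ℝ × ℝ) :
    pd v (pd w f) = pd w (pd v f) := by
  funext x
  have hd : DifferentiableAt ℝ (fderiv ℝ f) x :=
    (hf.fderiv_right (m := (⊤ : ℕ∞)) (by simp)).differentiable (by simp) x
  have key : ∀ u : ℝ × ℝ × ℝ, fderiv ℝ (fun y => fderiv ℝ f y u) x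
      = (fderiv ℝ (fderiv ℝ f) x).flip u := fun u => by
    rw [fderiv_clm_apply hd (differentiableAt_const u)]
    simp
  have hs := (hf.contDiffAt (x := x)).isSymmSndFDerivAt (by
    rw [minSmoothness_of_isRCLikeNormedField]
    exact WithTop.coe_le_coe.2 le_top)
  change fderiv ℝ (fun y => fderiv ℝ f y w) x v = fderiv ℝ (fun y => fderiv ℝ f y v) x w
  rw [key, key]
  exact hs v w

lemma pd_periodic {f : ℝ × ℝ × ℝ → ℝ} {c : ℝ × ℝ × ℝ} (hf : Function.Periodic f c)
    (v : ℝ × ℝ × ℝ) : Function.Periodic (pd v f) c := fun x => by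
  have h := fderiv_comp_add_right (𝕜 := ℝ) (f := f) (x := x) c
  rw [show (fun x => f (x + c)) = f from funext hf] at h
  simp only [pd, h]

lemma hasDerivAt_time {f : ℝ × ℝ × ℝ → ℝ} (hf : ContDiff ℝ (⊤ : ℕ∞) f) (t φ θ : ℝ) :
    HasDerivAt (fun s => f (s, φ, θ)) (pd (1, 0, 0) f (t, φ, θ)) t :=
  (hf.differentiable (by simp) (t, φ, θ)).hasFDerivAt.comp_hasDerivAt t
    ((hasDerivAt_id t).prodMk ((hasDerivAt_const t φ).prodMk (hasDerivAt_const t θ)))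

lemma hasDerivAt_lon {f : ℝ × ℝ × ℝ → ℝ} (hf : ContDiff ℝ (⊤ : ℕ∞) f) (t φ θ : ℝ) :
    HasDerivAt (fun s => f (t, s, θ)) (pd (0, 1, 0) f (t, φ, θ)) φ :=
  (hf.differentiable (by simp) (t, φ, θ)).hasFDerivAt.comp_hasDerivAt φ
    ((hasDerivAt_const φ t).prodMk ((hasDerivAt_id φ).prodMk (hasDerivAt_const φ θ)))

lemma hasDerivAt_lat {f : ℝ × ℝ × ℝ → ℝ} (hf : ContDiff ℝ (⊤ : ℕ∞) f) (t φ θ : ℝ) :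
    HasDerivAt (fun s => f (t, φ, s)) (pd (0, 0, 1) f (t, φ, θ)) θ :=
  (hf.differentiable (by simp) (t, φ, θ)).hasFDerivAt.comp_hasDerivAt θ
    ((hasDerivAt_const θ t).prodMk ((hasDerivAt_const θ φ).prodMk (hasDerivAt_id θ)))

lemma intervalIntegral_swap_of_continuous {f : ℝ → ℝ → ℝ} (hf : Continuous (Function.uncurry f))
    (a b c d : ℝ) :
    ∫ x in a..b, ∫ y in c..d, f x y = ∫ y in c..d, ∫ x in a..b, f x y := by
  refine intervalIntegral_intervalIntegral_swap ?_
  exact (hf.continuousOn.integrableOn_compact (isCompact_uIcc.prod isCompact_uIcc)).mono_set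
    (Set.prod_mono Set.uIoc_subset_uIcc Set.uIoc_subset_uIcc)

/-- A density whose time derivative is the divergence of a flux `(B, A)` with no net flow through
the boundary of a rectangle has a constant integral over that rectangle. -/
lemma integral_const_of_divergence {e A B a b : ℝ × ℝ × ℝ → ℝ} {p q r s : ℝ}
    (he : ∀ t φ θ, θ ∈ Set.uIcc r s →
      HasDerivAt (fun t' => e (t', φ, θ)) (a (t, φ, θ) + b (t, φ, θ)) t)
    (hA : ∀ t φ θ, HasDerivAt (fun θ' => A (t, φ, θ')) (a (t, φ, θ)) θ)
    (hB : ∀ t φ θ, HasDerivAt (fun φ' => B (t, φ', θ)) (b (t, φ, θ)) φ)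
    (hec : Continuous e) (hac : Continuous a) (hbc : Continuous b)
    (hA0 : ∀ t φ, A (t, φ, r) = A (t, φ, s)) (hB0 : ∀ t θ, B (t, p, θ) = B (t, q, θ))
    (t₁ t₂ : ℝ) :
    ∫ φ in p..q, ∫ θ in r..s, e (t₁, φ, θ) = ∫ φ in p..q, ∫ θ in r..s, e (t₂, φ, θ) := by
  have hflux : ∀ t, ∫ φ in p..q, ∫ θ in r..s, (a (t, φ, θ) + b (t, φ, θ)) = 0 := fun t => by
    have h1 : ∀ φ, ∫ θ in r..s, a (t, φ, θ) = 0 := fun φ => by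
      rw [intervalIntegral.integral_eq_sub_of_hasDerivAt (fun θ _ => hA t φ θ)
        (Continuous.intervalIntegrable (by fun_prop) _ _), hA0, sub_self]
    have h2 : ∀ θ, ∫ φ in p..q, b (t, φ, θ) = 0 := fun θ => by
      rw [intervalIntegral.integral_eq_sub_of_hasDerivAt (fun φ _ => hB t φ θ)
        (Continuous.intervalIntegrable (by fun_prop) _ _), hB0, sub_self]
    have h3 : ∀ φ, ∫ θ in r..s, (a (t, φ, θ) + b (t, φ, θ)) = ∫ θ in r..s, b (t, φ, θ) :=
      fun φ => by
        rw [intervalIntegral.integral_add (Continuous.intervalIntegrable (by fun_prop) _ _)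
          (Continuous.intervalIntegrable (by fun_prop) _ _), h1, zero_add]
    simp only [h3]
    rw [intervalIntegral_swap_of_continuous (f := fun φ θ => b (t, φ, θ)) (by fun_prop)]
    simp [h2]
  have hint : ∀ t, Continuous fun φ => ∫ θ in r..s, e (t, φ, θ) := fun t => by fun_prop
  have hin : ∀ φ, (∫ θ in r..s, e (t₂, φ, θ)) - ∫ θ in r..s, e (t₁, φ, θ)
      = ∫ t in t₁..t₂, ∫ θ in r..s, (a (t, φ, θ) + b (t, φ, θ)) := fun φ => by
    rw [← intervalIntegral.integral_sub (Continuous.intervalIntegrable (by fun_prop) _ _)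
      (Continuous.intervalIntegrable (by fun_prop) _ _),
      intervalIntegral_swap_of_continuous
        (f := fun t θ => a (t, φ, θ) + b (t, φ, θ)) (by fun_prop)]
    refine intervalIntegral.integral_congr fun θ hθ => ?_
    exact (intervalIntegral.integral_eq_sub_of_hasDerivAt (fun t _ => he t φ θ hθ)
      (Continuous.intervalIntegrable (by fun_prop) _ _)).symm
  rw [eq_comm, ← sub_eq_zero, ← intervalIntegral.integral_sub
    ((hint t₂).intervalIntegrable _ _) ((hint t₁).intervalIntegrable _ _)]
  simp only [hin]
  rw [intervalIntegral_swap_of_continuous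
    (f := fun φ t => ∫ θ in r..s, (a (t, φ, θ) + b (t, φ, θ))) (by fun_prop)]
  simp [hflux]

/-- The point of space-time with time `t`, longitude `φ` and latitude `θ`. -/
def timeSphPt (x : ℝ × ℝ × ℝ) : ℝ × (ℝ × ℝ × ℝ) := (x.1, sphPt x.2.1 x.2.2)

/-- The unit vector pointing east at longitude `φ`, as a space-time vector. -/
def eastVec (φ : ℝ) : ℝ × (ℝ × ℝ × ℝ) := (0, -sin φ, cos φ, 0)

/-- The northward velocity component `(1 / cos θ) ∂φΨ`, in a form that is smooth across the poles. -/
def eastDeriv (ψ : ℝ × (ℝ × ℝ × ℝ) → ℝ) (x : ℝ × ℝ × ℝ) : ℝ :=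
  fderiv ℝ ψ (timeSphPt x) (eastVec x.2.1)

/-- The vorticity of a stream function, in a form that is smooth across the poles. -/
def smoothVort (ψ : ℝ × (ℝ × ℝ × ℝ) → ℝ) (x : ℝ × ℝ × ℝ) : ℝ :=
  pd (0, 0, 1) (pd (0, 0, 1) (ψ ∘ timeSphPt)) x
    + (fderiv ℝ (fderiv ℝ ψ) (timeSphPt x) (eastVec x.2.1) (eastVec x.2.1)
      - fderiv ℝ ψ (timeSphPt x) (0, sphPt x.2.1 x.2.2))

lemma contDiff_timeSphPt : ContDiff ℝ (⊤ : ℕ∞) timeSphPt := by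
  unfold timeSphPt sphPt
  fun_prop

lemma contDiff_eastVec : ContDiff ℝ (⊤ : ℕ∞) eastVec := by
  unfold eastVec
  fun_prop

lemma timeSphPt_periodic : Function.Periodic timeSphPt (0, 2 * π, 0) := fun x => by
  simp [timeSphPt, sphPt]

section Smooth

variable {ψ : ℝ × (ℝ × ℝ × ℝ) → ℝ}

lemma contDiff_eastDeriv (hψ : ContDiff ℝ (⊤ : ℕ∞) ψ) : ContDiff ℝ (⊤ : ℕ∞) (eastDeriv ψ) :=
  ((hψ.fderiv_right (m := (⊤ : ℕ∞)) (by simp)).comp contDiff_timeSphPt).clm_apply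
    (contDiff_eastVec.comp (by fun_prop))

lemma contDiff_smoothVort (hψ : ContDiff ℝ (⊤ : ℕ∞) ψ) :
    ContDiff ℝ (⊤ : ℕ∞) (smoothVort ψ) := by
  have h1 := hψ.fderiv_right (m := (⊤ : ℕ∞)) (by simp)
  have h2 := h1.fderiv_right (m := (⊤ : ℕ∞)) (by simp)
  have he : ContDiff ℝ (⊤ : ℕ∞) fun x : ℝ × ℝ × ℝ => eastVec x.2.1 :=
    contDiff_eastVec.comp (by fun_prop)
  have hp : ContDiff ℝ (⊤ : ℕ∞)
      fun x : ℝ × ℝ × ℝ => ((0, sphPt x.2.1 x.2.2) : ℝ × (ℝ × ℝ × ℝ)) := by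
    unfold sphPt
    fun_prop
  exact (((hψ.comp contDiff_timeSphPt).pd _).pd _).add
    ((((h2.comp contDiff_timeSphPt).clm_apply he).clm_apply he).sub
      ((h1.comp contDiff_timeSphPt).clm_apply hp))

lemma eastDeriv_periodic : Function.Periodic (eastDeriv ψ) (0, 2 * π, 0) := fun x => by
  have h := timeSphPt_periodic x
  simp [eastDeriv, h, eastVec]

lemma smoothVort_periodic : Function.Periodic (smoothVort ψ) (0, 2 * π, 0) := fun x => by
  have h := timeSphPt_periodic x
  have h' := pd_periodic (pd_periodic (timeSphPt_periodic.comp ψ) (0, 0, 1)) (0, 0, 1) x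
  simp only [smoothVort, h, h']
  simp [eastVec, sphPt]

lemma hasDerivAt_timeSphPt_lon (t φ θ : ℝ) :
    HasDerivAt (fun s => timeSphPt (t, s, θ)) (cos θ • eastVec φ) φ := by
  have h := (hasDerivAt_const φ t).prodMk (((hasDerivAt_cos φ).mul_const (cos θ)).prodMk
    (((hasDerivAt_sin φ).mul_const (cos θ)).prodMk (hasDerivAt_const φ (sin θ))))
  exact h.congr_deriv (by simp [eastVec, mul_comm])

lemma hasDerivAt_timeSphPt_lat (t φ θ : ℝ) :
    HasDerivAt (fun s => timeSphPt (t, φ, s))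
      (0, -(cos φ * sin θ), -(sin φ * sin θ), cos θ) θ := by
  have h := (hasDerivAt_const θ t).prodMk (((hasDerivAt_cos θ).const_mul (cos φ)).prodMk
    (((hasDerivAt_cos θ).const_mul (sin φ)).prodMk (hasDerivAt_sin θ)))
  exact h.congr_deriv (by simp)

lemma pd_lon_eq (hψ : ContDiff ℝ (⊤ : ℕ∞) ψ) (t φ θ : ℝ) :
    pd (0, 1, 0) (ψ ∘ timeSphPt) (t, φ, θ) = cos θ * eastDeriv ψ (t, φ, θ) := by
  have h := (hψ.differentiable (by simp) (timeSphPt (t, φ, θ))).hasFDerivAt.comp_hasDerivAt φ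
    (hasDerivAt_timeSphPt_lon t φ θ)
  rw [(hasDerivAt_lon (hψ.comp contDiff_timeSphPt) t φ θ).unique h, map_smul, smul_eq_mul]
  rfl

lemma pd_lat_eq (hψ : ContDiff ℝ (⊤ : ℕ∞) ψ) (t φ θ : ℝ) :
    pd (0, 0, 1) (ψ ∘ timeSphPt) (t, φ, θ)
      = fderiv ℝ ψ (timeSphPt (t, φ, θ)) (0, -(cos φ * sin θ), -(sin φ * sin θ), cos θ) :=
  (hasDerivAt_lat (hψ.comp contDiff_timeSphPt) t φ θ).unique
    ((hψ.differentiable (by simp) (timeSphPt (t, φ, θ))).hasFDerivAt.comp_hasDerivAt θ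
      (hasDerivAt_timeSphPt_lat t φ θ))

lemma hasDerivAt_eastVec (φ : ℝ) : HasDerivAt eastVec (0, -cos φ, -sin φ, 0) φ :=
  (hasDerivAt_const φ (0 : ℝ)).prodMk ((hasDerivAt_sin φ).neg.prodMk
    ((hasDerivAt_cos φ).prodMk (hasDerivAt_const φ (0 : ℝ))))

lemma pd_lon_eastDeriv (hψ : ContDiff ℝ (⊤ : ℕ∞) ψ) (t φ θ : ℝ) :
    pd (0, 1, 0) (eastDeriv ψ) (t, φ, θ)
      = cos θ * fderiv ℝ (fderiv ℝ ψ) (timeSphPt (t, φ, θ)) (eastVec φ) (eastVec φ)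
        + fderiv ℝ ψ (timeSphPt (t, φ, θ)) (0, -cos φ, -sin φ, 0) := by
  have hd : DifferentiableAt ℝ (fderiv ℝ ψ) (timeSphPt (t, φ, θ)) :=
    (hψ.fderiv_right (m := (⊤ : ℕ∞)) (by simp)).differentiable (by simp) _
  have h : HasDerivAt (fun s => fderiv ℝ ψ (timeSphPt (t, s, θ)))
      (fderiv ℝ (fderiv ℝ ψ) (timeSphPt (t, φ, θ)) (cos θ • eastVec φ)) φ :=
    hd.hasFDerivAt.comp_hasDerivAt φ (hasDerivAt_timeSphPt_lon t φ θ)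
  rw [(hasDerivAt_lon (contDiff_eastDeriv hψ) t φ θ).unique
    (h.clm_apply (hasDerivAt_eastVec φ)), map_smul, smul_apply, smul_eq_mul]

lemma cos_mul_smoothVort (hψ : ContDiff ℝ (⊤ : ℕ∞) ψ) (t φ θ : ℝ) :
    cos θ * smoothVort ψ (t, φ, θ)
      = cos θ * pd (0, 0, 1) (pd (0, 0, 1) (ψ ∘ timeSphPt)) (t, φ, θ)
        - sin θ * pd (0, 0, 1) (ψ ∘ timeSphPt) (t, φ, θ)
        + pd (0, 1, 0) (eastDeriv ψ) (t, φ, θ) := by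
  have hvec : ((0, -cos φ, -sin φ, 0) : ℝ × (ℝ × ℝ × ℝ))
      = sin θ • ((0, -(cos φ * sin θ), -(sin φ * sin θ), cos θ) : ℝ × (ℝ × ℝ × ℝ))
        - cos θ • ((0, sphPt φ θ) : ℝ × (ℝ × ℝ × ℝ)) := by
    have := sin_sq_add_cos_sq θ
    simp only [sphPt, Prod.smul_mk, Prod.mk_sub_mk, smul_eq_mul, Prod.mk.injEq]
    refine ⟨by ring, ?_, ?_, by ring⟩
    · linear_combination (cos φ) * this
    · linear_combination (sin φ) * this
  rw [pd_lon_eastDeriv hψ, pd_lat_eq hψ, hvec, map_sub, map_smul, map_smul]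
  simp only [smoothVort, smul_eq_mul]
  ring

lemma LB_eq_smoothVort (hψ : ContDiff ℝ (⊤ : ℕ∞) ψ) (t φ : ℝ) {θ : ℝ} (hθ : cos θ ≠ 0) :
    LB (fun φ θ => ψ (t, sphPt φ θ)) φ θ = smoothVort ψ (t, φ, θ) := by
  have hF := hψ.comp contDiff_timeSphPt
  have h1 : deriv (fun θ' => ψ (t, sphPt φ θ'))
      = fun θ' => pd (0, 0, 1) (ψ ∘ timeSphPt) (t, φ, θ') :=
    funext fun θ' => (hasDerivAt_lat hF t φ θ').deriv
  have h2 : deriv (fun φ' => ψ (t, sphPt φ' θ))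
      = fun φ' => cos θ * eastDeriv ψ (t, φ', θ) :=
    funext fun φ' => (hasDerivAt_lon hF t φ' θ).deriv.trans (pd_lon_eq hψ t φ' θ)
  simp only [LB, iteratedDeriv_succ, iteratedDeriv_zero, h1, h2]
  rw [(hasDerivAt_lat (hF.pd _) t φ θ).deriv,
    ((hasDerivAt_lon (contDiff_eastDeriv hψ) t φ θ).const_mul (cos θ)).deriv, tan_eq_sin_div_cos]
  have := cos_mul_smoothVort hψ t φ θ
  field_simp
  linear_combination -this

end Smooth

lemma cos_mul_pd_time_smoothVort {ω : ℝ} {ψ : ℝ × (ℝ × ℝ × ℝ) → ℝ}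
    (hψ : ContDiff ℝ (⊤ : ℕ∞) ψ) (hE : EulerEq ω (fun t φ θ => ψ (t, sphPt φ θ)))
    (t φ : ℝ) {θ : ℝ} (hθ : θ ∈ Set.Icc (-(π / 2)) (π / 2)) :
    cos θ * pd (1, 0, 0) (smoothVort ψ) (t, φ, θ)
      + (pd (0, 1, 0) (ψ ∘ timeSphPt) (t, φ, θ)
          * (pd (0, 0, 1) (smoothVort ψ) (t, φ, θ) + 2 * ω * cos θ)
        - pd (0, 0, 1) (ψ ∘ timeSphPt) (t, φ, θ)
          * pd (0, 1, 0) (smoothVort ψ) (t, φ, θ)) = 0 := by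
  have hF := hψ.comp contDiff_timeSphPt
  have hQ := contDiff_smoothVort hψ
  have c1 := (hQ.pd (1, 0, 0)).continuous
  have c2 := (hQ.pd (0, 1, 0)).continuous
  have c3 := (hQ.pd (0, 0, 1)).continuous
  have c4 := (hF.pd (0, 1, 0)).continuous
  have c5 := (hF.pd (0, 0, 1)).continuous
  rw [← closure_Ioo (by linarith [pi_pos])] at hθ
  refine (isClosed_eq (f := fun θ => cos θ * pd (1, 0, 0) (smoothVort ψ) (t, φ, θ)
      + (pd (0, 1, 0) (ψ ∘ timeSphPt) (t, φ, θ)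
          * (pd (0, 0, 1) (smoothVort ψ) (t, φ, θ) + 2 * ω * cos θ)
        - pd (0, 0, 1) (ψ ∘ timeSphPt) (t, φ, θ)
          * pd (0, 1, 0) (smoothVort ψ) (t, φ, θ))) (g := fun _ => 0)
    (by fun_prop) continuous_const).closure_subset_iff.2 (fun θ hθ => ?_) hθ
  have hc : 0 < cos θ := cos_pos_of_mem_Ioo hθ
  have h := hE t φ θ hθ
  have e1 : (fun t' => LB (fun φ θ => ψ (t', sphPt φ θ)) φ θ)
      = fun t' => smoothVort ψ (t', φ, θ) :=
    funext fun t' => LB_eq_smoothVort hψ t' φ hc.ne'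
  have e2 : (fun φ' => LB (fun φ θ => ψ (t, sphPt φ θ)) φ' θ + 2 * ω * sin θ)
      = fun φ' => smoothVort ψ (t, φ', θ) + 2 * ω * sin θ :=
    funext fun φ' => by rw [LB_eq_smoothVort hψ t φ' hc.ne']
  have e3 : (fun θ' => LB (fun φ θ => ψ (t, sphPt φ θ)) φ θ' + 2 * ω * sin θ')
      =ᶠ[nhds θ] fun θ' => smoothVort ψ (t, φ, θ') + 2 * ω * sin θ' := by
    filter_upwards [isOpen_Ioo.mem_nhds hθ] with θ' hθ'
    rw [LB_eq_smoothVort hψ t φ (cos_pos_of_mem_Ioo hθ').ne']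
  have d1 : deriv (fun φ' => ψ (t, sphPt φ' θ)) φ = pd (0, 1, 0) (ψ ∘ timeSphPt) (t, φ, θ) :=
    (hasDerivAt_lon hF t φ θ).deriv
  have d2 : deriv (fun θ' => ψ (t, sphPt φ θ')) θ = pd (0, 0, 1) (ψ ∘ timeSphPt) (t, φ, θ) :=
    (hasDerivAt_lat hF t φ θ).deriv
  have d3 : deriv (fun θ' => smoothVort ψ (t, φ, θ') + 2 * ω * sin θ') θ
      = pd (0, 0, 1) (smoothVort ψ) (t, φ, θ) + 2 * ω * cos θ :=
    ((hasDerivAt_lat hQ t φ θ).add ((hasDerivAt_sin θ).const_mul (2 * ω))).deriv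
  rw [e1, e2, e3.deriv_eq, d1, d2, d3, (hasDerivAt_time hQ t φ θ).deriv,
    ((hasDerivAt_lon hQ t φ θ).add_const _).deriv] at h
  field_simp at h
  simp only [Set.mem_ofPred_eq]
  linear_combination h

/-- Conservation of kinetic energy: along a smooth solution of the vorticity equation `(E_ω)`,
`(1/2)∫∫ [(∂θΨ)² + (∂φΨ)²/cos²θ] cos θ dθ dφ` is constant in time. -/
theorem kinetic_energy_conserved (ω : ℝ) (ψ : ℝ × (ℝ × ℝ × ℝ) → ℝ)
    (hψ : ContDiff ℝ (⊤ : ℕ∞) ψ)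
    (hE : EulerEq ω (fun t φ θ => ψ (t, sphPt φ θ))) :
    ∀ t₁ t₂ : ℝ,
      (1/2) * (∫ φ in (0:ℝ)..(2*π), ∫ θ in (-(π/2))..(π/2),
          ((deriv (fun θ' => ψ (t₁, sphPt φ θ')) θ) ^ 2
            + (deriv (fun φ' => ψ (t₁, sphPt φ' θ)) φ) ^ 2 / Real.cos θ ^ 2) * Real.cos θ)
      = (1/2) * (∫ φ in (0:ℝ)..(2*π), ∫ θ in (-(π/2))..(π/2),
          ((deriv (fun θ' => ψ (t₂, sphPt φ θ')) θ) ^ 2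
            + (deriv (fun φ' => ψ (t₂, sphPt φ' θ)) φ) ^ 2 / Real.cos θ ^ 2) * Real.cos θ) := by
  intro t₁ t₂
  set F : ℝ × ℝ × ℝ → ℝ := ψ ∘ timeSphPt with hFdef
  set G := eastDeriv ψ with hGdef
  set Q := smoothVort ψ with hQdef
  have hF : ContDiff ℝ (⊤ : ℕ∞) F := hψ.comp contDiff_timeSphPt
  have hG : ContDiff ℝ (⊤ : ℕ∞) G := contDiff_eastDeriv hψ
  have hQ : ContDiff ℝ (⊤ : ℕ∞) Q := contDiff_smoothVort hψ
  have hdens : ∀ t φ θ, ((deriv (fun θ' => ψ (t, sphPt φ θ')) θ) ^ 2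
      + (deriv (fun φ' => ψ (t, sphPt φ' θ)) φ) ^ 2 / cos θ ^ 2) * cos θ
      = (pd (0, 0, 1) F (t, φ, θ) ^ 2 + G (t, φ, θ) ^ 2) * cos θ := fun t φ θ => by
    have d1 : deriv (fun φ' => ψ (t, sphPt φ' θ)) φ = cos θ * G (t, φ, θ) :=
      (hasDerivAt_lon hF t φ θ).deriv.trans (pd_lon_eq hψ t φ θ)
    have d2 : deriv (fun θ' => ψ (t, sphPt φ θ')) θ = pd (0, 0, 1) F (t, φ, θ) :=
      (hasDerivAt_lat hF t φ θ).deriv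
    rw [d1, d2]
    by_cases hc : cos θ = 0
    · simp [hc]
    · field_simp
  simp only [hdens]
  congr 1
  have hFt := hF.pd (0, 0, 1)
  have hFp := hF.pd (0, 1, 0)
  have hFtt := hFt.pd (1, 0, 0)
  have hGt := hG.pd (1, 0, 0)
  have cF := hF.continuous
  have cG := hG.continuous
  have cQ := hQ.continuous
  have cFt := hFt.continuous
  have cFp := hFp.continuous
  have cFtt := hFtt.continuous
  have cGt := hGt.continuous
  have cFttt := (hFtt.pd (0, 0, 1)).continuous
  have cGtp := (hGt.pd (0, 1, 0)).continuous
  have cFpt := (hFp.pd (0, 0, 1)).continuous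
  have cFtp := (hFt.pd (0, 1, 0)).continuous
  have cQp := (hQ.pd (0, 1, 0)).continuous
  have cQt := (hQ.pd (0, 0, 1)).continuous
  have pF : Function.Periodic F (0, 2 * π, 0) := timeSphPt_periodic.comp ψ
  have hflux := integral_const_of_divergence
    (e := fun x => (pd (0, 0, 1) F x ^ 2 + G x ^ 2) * cos x.2.2)
    (A := fun x => 2 * (F x * (cos x.2.2 * pd (1, 0, 0) (pd (0, 0, 1) F) x)
      + F x * pd (0, 1, 0) F x * (Q x + 2 * ω * sin x.2.2)))
    (B := fun x => 2 * (F x * pd (1, 0, 0) G x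
      - F x * pd (0, 0, 1) F x * (Q x + 2 * ω * sin x.2.2)))
    (a := fun x => 2 * (pd (0, 0, 1) F x * (cos x.2.2 * pd (1, 0, 0) (pd (0, 0, 1) F) x)
      + F x * (-sin x.2.2 * pd (1, 0, 0) (pd (0, 0, 1) F) x
        + cos x.2.2 * pd (0, 0, 1) (pd (1, 0, 0) (pd (0, 0, 1) F)) x)
      + ((pd (0, 0, 1) F x * pd (0, 1, 0) F x + F x * pd (0, 0, 1) (pd (0, 1, 0) F) x)
          * (Q x + 2 * ω * sin x.2.2)
        + F x * pd (0, 1, 0) F x * (pd (0, 0, 1) Q x + 2 * ω * cos x.2.2))))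
    (b := fun x => 2 * (pd (0, 1, 0) F x * pd (1, 0, 0) G x
        + F x * pd (0, 1, 0) (pd (1, 0, 0) G) x
      - ((pd (0, 1, 0) F x * pd (0, 0, 1) F x + F x * pd (0, 1, 0) (pd (0, 0, 1) F) x)
          * (Q x + 2 * ω * sin x.2.2)
        + F x * pd (0, 0, 1) F x * pd (0, 1, 0) Q x)))
    (p := 0) (q := 2 * π) (r := -(π / 2)) (s := π / 2)
    ?_ ?_ ?_ (by fun_prop) (by fun_prop) (by fun_prop) ?_ ?_ t₁ t₂
  · exact hflux
  · intro t φ θ hθ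
    rw [Set.uIcc_of_le (by linarith [pi_pos])] at hθ
    have hvort : cos θ * pd (1, 0, 0) Q (t, φ, θ)
        = cos θ * pd (0, 0, 1) (pd (1, 0, 0) (pd (0, 0, 1) F)) (t, φ, θ)
          - sin θ * pd (1, 0, 0) (pd (0, 0, 1) F) (t, φ, θ)
          + pd (0, 1, 0) (pd (1, 0, 0) G) (t, φ, θ) := by
      rw [pd_comm hFt (0, 0, 1) (1, 0, 0), pd_comm hG (0, 1, 0) (1, 0, 0)]
      refine ((hasDerivAt_time hQ t φ θ).const_mul (cos θ)).unique ?_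
      have h := (((hasDerivAt_time (hFt.pd (0, 0, 1)) t φ θ).const_mul (cos θ)).sub
        ((hasDerivAt_time hFt t φ θ).const_mul (sin θ))).add
        (hasDerivAt_time (hG.pd (0, 1, 0)) t φ θ)
      exact h.congr_of_eventuallyEq (.of_forall fun s => cos_mul_smoothVort hψ s φ θ)
    have heuler := cos_mul_pd_time_smoothVort hψ hE t φ hθ
    have hlon := pd_lon_eq hψ t φ θ
    rw [← hFdef, ← hGdef] at hlon
    rw [← hFdef, ← hQdef] at heuler
    refine ((((hasDerivAt_time hFt t φ θ).pow 2).add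
      ((hasDerivAt_time hG t φ θ).pow 2)).mul_const (cos θ)).congr_deriv ?_
    simp only [pd_comm hF (0, 0, 1) (0, 1, 0)]
    push_cast
    linear_combination 2 * F (t, φ, θ) * hvort - 2 * F (t, φ, θ) * heuler
      - 2 * pd (1, 0, 0) G (t, φ, θ) * hlon
  · intro t φ θ
    exact (((hasDerivAt_lat hF t φ θ).mul
      ((hasDerivAt_cos θ).mul (hasDerivAt_lat hFtt t φ θ))).add
      (((hasDerivAt_lat hF t φ θ).mul (hasDerivAt_lat hFp t φ θ)).mul
        ((hasDerivAt_lat hQ t φ θ).add ((hasDerivAt_sin θ).const_mul (2 * ω))))).const_mul 2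
  · intro t φ θ
    exact (((hasDerivAt_lon hF t φ θ).mul (hasDerivAt_lon hGt t φ θ)).sub
      (((hasDerivAt_lon hF t φ θ).mul (hasDerivAt_lon hFt t φ θ)).mul
        ((hasDerivAt_lon hQ t φ θ).add_const (2 * ω * sin θ)))).const_mul 2
  · intro t φ
    simp [hFdef, pd_lon_eq hψ]
  · intro t θ
    have hper : ∀ {f : ℝ × ℝ × ℝ → ℝ}, Function.Periodic f (0, 2 * π, 0) →
        f (t, 2 * π, θ) = f (t, 0, θ) := fun hf => by simpa using hf (t, 0, θ)
    simp only [hper pF, hper (pd_periodic pF (0, 0, 1)), hper (smoothVort_periodic (ψ := ψ)),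
      hper (pd_periodic (eastDeriv_periodic (ψ := ψ)) (1, 0, 0)), hQdef, hGdef]
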